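/- arXiv:1001.1827 — 2 statements merged into one kernel-verified Lean document; each statement's English description precedes it below -/
import Mathlib

section
/- Let H be a complex Hilbert space, ι a countable index set, and K_k (k ∈ ι) bounded operators on H satisfying K_l ∘ K_k = δ_{lk} K_k for all k, l ∈ ι. For a finite subset X ⊆ ι and a bounded operator T on H define the state transformer I(X)(T) = Σ_{k∈X} K_k T K_k†, where K_k† is the adjoint. Then for all finite subsets X, Y ⊆ ι and all bounded T: I(Y)(I(X)(T)) = I(Y ∩ X)(T). In particular, when H is finite-dimensional, tr[I(Y)(I(X)(T))] = tr[I(Y ∩ X)(T)] (the repeatability condition). -/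
/- STATEMENT 5.  If bounded operators K_k satisfy K_l ∘ K_k = δ_{lk} K_k, the
state transformer I(X)(T) = Σ_{k∈X} K_k T K_k† satisfies
I(Y)(I(X)(T)) = I(Y ∩ X)(T); in particular the traces agree
(the repeatability condition). -/

noncomputable def stateTransformer {H : Type*} [NormedAddCommGroup H]
    [InnerProductSpace ℂ H] [CompleteSpace H] {ι : Type*}
    (K : ι → H →L[ℂ] H) (X : Finset ι) (T : H →L[ℂ] H) : H →L[ℂ] H :=
  ∑ k ∈ X, (K k).comp (T.comp (ContinuousLinearMap.adjoint (K k)))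

theorem stateTransformer_repeatable {H : Type*} [NormedAddCommGroup H]
    [InnerProductSpace ℂ H] [CompleteSpace H]
    {ι : Type*} [Countable ι] [DecidableEq ι]
    (K : ι → H →L[ℂ] H)
    (hK : ∀ l k : ι, (K l).comp (K k) = if l = k then K k else 0) :
    ∀ (X Y : Finset ι) (T : H →L[ℂ] H),
      stateTransformer K Y (stateTransformer K X T) = stateTransformer K (Y ∩ X) T ∧
      LinearMap.trace ℂ H (stateTransformer K Y (stateTransformer K X T)).toLinearMap =
        LinearMap.trace ℂ H (stateTransformer K (Y ∩ X) T).toLinearMap := by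
  intro X Y T
  suffices h : stateTransformer K Y (stateTransformer K X T) = stateTransformer K (Y ∩ X) T from
    ⟨h, by rw [h]⟩
  have key : ∀ l k : ι, (K l).comp (((K k).comp (T.comp (ContinuousLinearMap.adjoint (K k)))).comp
      (ContinuousLinearMap.adjoint (K l))) =
      if l = k then (K k).comp (T.comp (ContinuousLinearMap.adjoint (K k))) else 0 := by
    intro l k
    calc
      _ = ((K l).comp (K k)).comp (T.comp (ContinuousLinearMap.adjoint ((K l).comp (K k)))) := by
        rw [ContinuousLinearMap.adjoint_comp]
        rfl
      _ = _ := by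
        rw [hK]
        split_ifs <;> simp
  simp only [stateTransformer, ContinuousLinearMap.finsetSum_comp,
    ContinuousLinearMap.comp_finsetSum, key, Finset.sum_ite_eq, Finset.sum_ite_mem]
end

section
/- Let c, d : ι → ℂ with Σ_k |c_k|² = Σ_k |d_k|² = 1, and set Φ = Σ_k c_k φ_k⊗φ'_k and Φ̃ = Σ_k d_k φ_k⊗φ'_k. Suppose that ⟨Φ, (P_k⊗1)Φ⟩ = ⟨Φ̃, (P_k⊗1)Φ̃⟩ for all k ∈ ι, and that ⟨Φ, (P_{αkl}⊗P'_{βkl})Φ⟩ = ⟨Φ̃, (P_{αkl}⊗P'_{βkl})Φ̃⟩ for all k ≠ l and for the two choices (α, β) = (0, 0) and (α, β) = (π/2, 0). Then there exists u ∈ ℂ with |u| = 1 such that d_k = u·c_k for all k, i.e., Φ̃ = u·Φ; thus the correlations of the observables P_{αkl}, P'_{βkl} with α+β ∈ {0, π/2}, together with the single-system probabilities, determine the entangled vector state Φ up to a common phase. -/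
/- STATEMENT 16.  If two Schmidt-form unit vectors Φ = Σ c_k φ_k⊗φ'_k and
Φ̃ = Σ d_k φ_k⊗φ'_k have the same expectations of P_k⊗1 for all k and the same
correlations ⟨P_{αkl}⊗P'_{βkl}⟩ for all k ≠ l and (α,β) ∈ {(0,0), (π/2,0)},
then d_k = u·c_k for a common phase u, i.e. Φ̃ = u·Φ: these correlations
together with the single-system probabilities determine the entangled state up
to a common phase.  `HT` plays the role of the completed Hilbert tensor
product `H ⊗ H'`; `TOp O O'` is the operator `O ⊗ O'`. -/

open scoped InnerProductSpace ComplexConjugate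

/-- |u⟩⟨v| : x ↦ ⟨v, x⟩ • u. -/
noncomputable def ketBra {E : Type*} [NormedAddCommGroup E] [InnerProductSpace ℂ E]
    (u v : E) : E →L[ℂ] E :=
  ((innerSL ℂ) v).smulRight u

/-- P_{αkl} = e^{iα}|u⟩⟨v| + e^{−iα}|v⟩⟨u|. -/
noncomputable def offDiag {E : Type*} [NormedAddCommGroup E] [InnerProductSpace ℂ E]
    (α : ℝ) (u v : E) : E →L[ℂ] E :=
  Complex.exp (α * Complex.I) • ketBra u v + Complex.exp (-(α * Complex.I)) • ketBra v u

theorem ketBra_apply {E : Type*} [NormedAddCommGroup E] [InnerProductSpace ℂ E] (u v x : E) :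
    ketBra u v x = ⟪v, x⟫_ℂ • u := rfl

theorem offDiag_apply {E : Type*} [NormedAddCommGroup E] [InnerProductSpace ℂ E]
    (α : ℝ) (u v x : E) :
    offDiag α u v x = (Complex.exp (α * Complex.I) * ⟪v, x⟫_ℂ) • u +
      (Complex.exp (-(α * Complex.I)) * ⟪u, x⟫_ℂ) • v := by
  simp [offDiag, ketBra_apply, smul_smul]

section Orthonormal

variable {E ι : Type*} [NormedAddCommGroup E] [InnerProductSpace ℂ E]

/-- A continuous linear map killing all but finitely many terms of a convergent series
sends its sum to a finite sum. -/
theorem ContinuousLinearMap.map_hasSum_smul_eq_sum {F : Type*} [NormedAddCommGroup F]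
    [NormedSpace ℂ F] (T : E →L[ℂ] F) {e : ι → E} {c : ι → ℂ} {x : E}
    (hx : HasSum (fun k => c k • e k) x) (s : Finset ι) (hs : ∀ m ∉ s, T (e m) = 0) :
    T x = ∑ m ∈ s, c m • T (e m) := by
  have h := hx.mapL T
  simp only [map_smul] at h
  exact h.unique (hasSum_sum_of_ne_finset_zero fun m hm => by simp [hs m hm])

theorem Orthonormal.inner_right_hasSum {e : ι → E} (he : Orthonormal ℂ e) {c : ι → ℂ} {x : E}
    (hx : HasSum (fun k => c k • e k) x) (k : ι) : ⟪e k, x⟫_ℂ = c k := by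
  rw [← innerSL_apply_apply ℂ, (innerSL ℂ (e k)).map_hasSum_smul_eq_sum hx {k} fun m hm => by
    simpa using he.2 fun h => hm (by simp [h])]
  simp [he.1 k]

theorem Orthonormal.inner_apply_self_of_map_eq_self {e : ι → E} (he : Orthonormal ℂ e)
    {c : ι → ℂ} {x : E} (hx : HasSum (fun k => c k • e k) x) (T : E →L[ℂ] E)
    {k : ι} (hk : T (e k) = e k)
    (h0 : ∀ m, m ≠ k → T (e m) = 0) : ⟪x, T x⟫_ℂ = (‖c k‖ : ℂ) ^ 2 := by
  rw [T.map_hasSum_smul_eq_sum hx {k} (by simpa using h0), Finset.sum_singleton, hk,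
    inner_smul_right, ← inner_conj_symm, he.inner_right_hasSum hx, Complex.mul_conj']

theorem Orthonormal.inner_apply_self_of_map_swap {e : ι → E} (he : Orthonormal ℂ e)
    {c : ι → ℂ} {x : E} (hx : HasSum (fun k => c k • e k) x) (T : E →L[ℂ] E)
    {k l : ι} (hkl : k ≠ l) {a b : ℂ}
    (hk : T (e k) = b • e l) (hl : T (e l) = a • e k)
    (h0 : ∀ m, m ≠ k → m ≠ l → T (e m) = 0) :
    ⟪x, T x⟫_ℂ = a * (conj (c k) * c l) + b * conj (conj (c k) * c l) := by
  classical
  have hconj (m : ι) : ⟪x, e m⟫_ℂ = conj (c m) := by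
    rw [← inner_conj_symm, he.inner_right_hasSum hx]
  rw [T.map_hasSum_smul_eq_sum hx {k, l} (by simpa using h0), Finset.sum_pair hkl, hk, hl]
  simp only [inner_add_right, inner_smul_right, hconj, map_mul, Complex.conj_conj]
  ring

end Orthonormal

theorem Complex.eq_of_add_conj_eq_of_I_mul_sub_conj_eq {z w : ℂ} (h₁ : z + conj z = w + conj w)
    (h₂ : I * z + -I * conj z = I * w + -I * conj w) : z = w := by
  have h : z - conj z = w - conj w :=
    mul_left_cancel₀ I_ne_zero (by linear_combination h₂)
  linear_combination (h₁ + h) / 2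

/-- A nonzero family `c` is determined up to a phase by the products `conj (c k) * c l`. -/
theorem exists_phase_of_conj_mul_eq {ι : Type*} {c d : ι → ℂ} (hc : ∃ k, c k ≠ 0)
    (h : ∀ k l, conj (c k) * c l = conj (d k) * d l) :
    ∃ u : ℂ, ‖u‖ = 1 ∧ ∀ k, d k = u * c k := by
  obtain ⟨k, hk⟩ := hc
  have hnorm : ‖c k‖ = ‖d k‖ := by
    have hkk := congrArg norm (h k k)
    simp only [norm_mul, RCLike.norm_conj, ← sq] at hkk
    exact (sq_eq_sq₀ (norm_nonneg _) (norm_nonneg _)).mp hkk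
  have hdk : conj (d k) ≠ 0 := by
    simpa [← norm_eq_zero (a := d k), ← hnorm] using hk
  refine ⟨d k / c k, by rw [norm_div, hnorm, div_self (by simpa [← hnorm] using hk)], fun l => ?_⟩
  apply mul_left_cancel₀ hdk
  rw [← h k l]
  field_simp
  linear_combination c l * h k k

/-- The correlation of two off-diagonal observables in a vector in Schmidt form. -/
theorem inner_offDiag_tensor_offDiag
    {H H' HT ι : Type*}
    [NormedAddCommGroup H] [InnerProductSpace ℂ H]
    [NormedAddCommGroup H'] [InnerProductSpace ℂ H']
    [NormedAddCommGroup HT] [InnerProductSpace ℂ HT]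
    {b : ι → H} {b' : ι → H'} (hb : Orthonormal ℂ b) (hb' : Orthonormal ℂ b')
    (tp : H →ₗ[ℂ] H' →ₗ[ℂ] HT) (he : Orthonormal ℂ fun k => tp (b k) (b' k))
    {k l : ι} (hkl : k ≠ l) {α β : ℝ} (T : HT →L[ℂ] HT)
    (hT : ∀ x y, T (tp x y) = tp (offDiag α (b k) (b l) x) (offDiag β (b' k) (b' l) y))
    {c : ι → ℂ} {x : HT} (hx : HasSum (fun k => c k • tp (b k) (b' k)) x) :
    ⟪x, T x⟫_ℂ = Complex.exp ((α + β) * Complex.I) * (conj (c k) * c l) +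
      Complex.exp (-((α + β) * Complex.I)) * conj (conj (c k) * c l) := by
  classical
  refine he.inner_apply_self_of_map_swap hx T hkl ?_ ?_ ?_
  · simp [hT, offDiag_apply, orthonormal_iff_ite.mp hb, orthonormal_iff_ite.mp hb', hb.1, hb'.1,
      hkl.symm, smul_smul, mul_add, Complex.exp_add, mul_comm, add_comm]
  · simp [hT, offDiag_apply, orthonormal_iff_ite.mp hb, orthonormal_iff_ite.mp hb', hb.1, hb'.1,
      hkl, smul_smul, mul_add, Complex.exp_add, mul_comm]
  · intro m hmk hml
    simp [hT, offDiag_apply, orthonormal_iff_ite.mp hb, hmk.symm, hml.symm]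

theorem correlations_determine_state_up_to_phase
    {H H' HT : Type*}
    [NormedAddCommGroup H] [InnerProductSpace ℂ H] [CompleteSpace H]
    [NormedAddCommGroup H'] [InnerProductSpace ℂ H'] [CompleteSpace H']
    [NormedAddCommGroup HT] [InnerProductSpace ℂ HT] [CompleteSpace HT]
    {ι : Type*} [Countable ι]
    (B : HilbertBasis ι ℂ H) (B' : HilbertBasis ι ℂ H')
    (tp : H →ₗ[ℂ] H' →ₗ[ℂ] HT)
    (htp : ∀ (x x' : H) (y y' : H'),
      ⟪tp x y, tp x' y'⟫_ℂ = ⟪x, x'⟫_ℂ * ⟪y, y'⟫_ℂ)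
    (hdense : Dense ((Submodule.span ℂ
      (Set.range fun p : H × H' => tp p.1 p.2) : Submodule ℂ HT) : Set HT))
    -- TOp O O' = O ⊗ O'
    (TOp : (H →L[ℂ] H) → (H' →L[ℂ] H') → (HT →L[ℂ] HT))
    (hTOp : ∀ (O : H →L[ℂ] H) (O' : H' →L[ℂ] H') (x : H) (y : H'),
      TOp O O' (tp x y) = tp (O x) (O' y))
    (c d : ι → ℂ)
    (hc : HasSum (fun k => ‖c k‖ ^ 2) 1) (hd : HasSum (fun k => ‖d k‖ ^ 2) 1)
    (Φ : HT) (hΦ : HasSum (fun k => c k • tp (B k) (B' k)) Φ)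
    (Φ' : HT) (hΦ' : HasSum (fun k => d k • tp (B k) (B' k)) Φ')
    -- equal single-system probabilities
    (hprob : ∀ k : ι,
      ⟪Φ, TOp (ketBra (B k) (B k)) (ContinuousLinearMap.id ℂ H') Φ⟫_ℂ =
      ⟪Φ', TOp (ketBra (B k) (B k)) (ContinuousLinearMap.id ℂ H') Φ'⟫_ℂ)
    -- equal correlations for (α,β) = (0,0) and (α,β) = (π/2,0)
    (hcorr : ∀ k l : ι, k ≠ l → ∀ α β : ℝ,
      ((α = 0 ∧ β = 0) ∨ (α = Real.pi / 2 ∧ β = 0)) →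
      ⟪Φ, TOp (offDiag α (B k) (B l)) (offDiag β (B' k) (B' l)) Φ⟫_ℂ =
      ⟪Φ', TOp (offDiag α (B k) (B l)) (offDiag β (B' k) (B' l)) Φ'⟫_ℂ) :
    ∃ u : ℂ, ‖u‖ = 1 ∧ (∀ k : ι, d k = u * c k) ∧ Φ' = u • Φ := by
  classical
  have he : Orthonormal ℂ fun k => tp (B k) (B' k) := by
    rw [orthonormal_iff_ite]
    intro i j
    rw [htp, orthonormal_iff_ite.mp B.orthonormal, orthonormal_iff_ite.mp B'.orthonormal]
    split_ifs <;> simp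
  have hdiag (k : ι) : conj (c k) * c k = conj (d k) * d k := by
    have hk : TOp (ketBra (B k) (B k)) (.id ℂ H') (tp (B k) (B' k)) = tp (B k) (B' k) := by
      simp [hTOp, ketBra_apply, B.orthonormal.1]
    have h0 (m : ι) (hm : m ≠ k) :
        TOp (ketBra (B k) (B k)) (.id ℂ H') (tp (B m) (B' m)) = 0 := by
      simp [hTOp, ketBra_apply, orthonormal_iff_ite.mp B.orthonormal, hm.symm]
    simpa only [he.inner_apply_self_of_map_eq_self hΦ _ hk h0,
      he.inner_apply_self_of_map_eq_self hΦ' _ hk h0, Complex.conj_mul'] using hprob k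
  have hgram (k l : ι) : conj (c k) * c l = conj (d k) * d l := by
    rcases eq_or_ne k l with rfl | hkl
    · exact hdiag k
    have key {α β : ℝ} (h : (α = 0 ∧ β = 0) ∨ (α = Real.pi / 2 ∧ β = 0)) :=
      hcorr k l hkl α β h
    simp only [inner_offDiag_tensor_offDiag B.orthonormal B'.orthonormal tp he hkl _
      (hTOp _ _) hΦ, inner_offDiag_tensor_offDiag B.orthonormal B'.orthonormal tp he hkl _
      (hTOp _ _) hΦ'] at key
    have h₁ := key (.inl ⟨rfl, rfl⟩)
    have h₂ := key (.inr ⟨rfl, rfl⟩)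
    simp only [Complex.ofReal_zero, add_zero, zero_mul, neg_zero, Complex.exp_zero, one_mul] at h₁
    simp only [Complex.ofReal_zero, add_zero, Complex.ofReal_div, Complex.ofReal_ofNat,
      Complex.exp_neg, Complex.exp_pi_div_two_mul_I, Complex.inv_I] at h₂
    exact Complex.eq_of_add_conj_eq_of_I_mul_sub_conj_eq h₁ h₂
  have hne : ∃ k, c k ≠ 0 := by
    by_contra! h
    simpa [h] using hc.tsum_eq
  obtain ⟨u, hu, hdc⟩ := exists_phase_of_conj_mul_eq hne hgram
  refine ⟨u, hu, hdc, hΦ'.unique ?_⟩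
  simpa only [hdc, mul_smul] using hΦ.const_smul u
end
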